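/- Let x ∈ (0,1] and let f : [0,1] → ℝ be twice continuously differentiable on [0,1]. Then the limit as n → ∞ of n · ( B_{n,2}^{[1]}f(x) - B_n^{[1]}f(x) ) equals -((1-x)/2) · f'(x). -/

import Mathlib

open Filter Finset

/-- Bernstein basis polynomial `p_{n,k}(x) = C(n,k) x^k (1-x)^{n-k}`. -/
noncomputable def bern (n k : ℕ) (x : ℝ) : ℝ := (n.choose k : ℝ) * x ^ k * (1 - x) ^ (n - k)

/-- The classical Bernstein operator `B_n^{[1]} f(x) = Σ_{k=0}^n f(k/n) p_{n,k}(x)`. -/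
noncomputable def bernsteinOp (n : ℕ) (f : ℝ → ℝ) (x : ℝ) : ℝ :=
  ∑ k ∈ Finset.range (n + 1), f ((k : ℝ) / n) * bern n k x

/-- The AKR node `t_{n,k} = √(k(k-1)/(n(n-1)))`. -/
noncomputable def akrNode (n k : ℕ) : ℝ := Real.sqrt ((k * (k - 1)) / (n * (n - 1)))

/-- The Aldaz–Kounchev–Render operator with `j = 2`:
`B_{n,2}^{[1]} f(x) = Σ_{k=0}^n f(t_{n,k}) p_{n,k}(x)`. -/
noncomputable def akrOp (n : ℕ) (f : ℝ → ℝ) (x : ℝ) : ℝ :=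
  ∑ k ∈ Finset.range (n + 1), f (akrNode n k) * bern n k x

lemma bern_eq_eval (n k : ℕ) (x : ℝ) : bern n k x = (bernsteinPolynomial ℝ n k).eval x := by
  simp [bern, bernsteinPolynomial]

lemma bern_nonneg (n k : ℕ) {x : ℝ} (hx : x ∈ Set.Icc (0 : ℝ) 1) : 0 ≤ bern n k x := by
  have h0 := hx.1
  have h1 : 0 ≤ 1 - x := sub_nonneg.2 hx.2
  unfold bern
  positivity

lemma sum_bern (n : ℕ) (x : ℝ) : ∑ k ∈ range (n + 1), bern n k x = 1 := by
  simp only [bern_eq_eval, ← Polynomial.eval_finsetSum, bernsteinPolynomial.sum,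
    Polynomial.eval_one]

lemma sum_sq_sub_mul_bern {n : ℕ} (hn : n ≠ 0) (x : ℝ) :
    ∑ k ∈ range (n + 1), ((k : ℝ) / n - x) ^ 2 * bern n k x = x * (1 - x) / n := by
  have hn' : (n : ℝ) ≠ 0 := Nat.cast_ne_zero.2 hn
  have h := congrArg (Polynomial.eval x) (bernsteinPolynomial.variance (R := ℝ) n)
  simp only [Polynomial.eval_finsetSum, nsmul_eq_mul, Polynomial.eval_mul, Polynomial.eval_pow,
    Polynomial.eval_sub, Polynomial.eval_natCast, Polynomial.eval_X, Polynomial.eval_one,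
    ← bern_eq_eval] at h
  calc ∑ k ∈ range (n + 1), ((k : ℝ) / n - x) ^ 2 * bern n k x
      = ∑ k ∈ range (n + 1), ((n : ℝ) * x - k) ^ 2 * bern n k x / (n : ℝ) ^ 2 := by
        refine sum_congr rfl fun k _ => ?_
        field_simp
        ring
    _ = x * (1 - x) / n := by
        rw [← sum_div, h]
        field_simp

/-- Bernstein averages of a bounded array that converges near `x` converge to the local limit. -/
lemma tendsto_sum_mul_bern {x : ℝ} (hx : x ∈ Set.Icc (0 : ℝ) 1) (φ : ℕ → ℕ → ℝ) (c M : ℝ)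
    (hM : ∀ᶠ n in atTop, ∀ k ≤ n, |φ n k - c| ≤ M)
    (hloc : ∀ ε > 0, ∃ δ > 0, ∀ᶠ n : ℕ in atTop, ∀ k ≤ n, |(k : ℝ) / n - x| < δ →
      |φ n k - c| ≤ ε) :
    Tendsto (fun n : ℕ => ∑ k ∈ range (n + 1), φ n k * bern n k x) atTop (nhds c) := by
  rw [Metric.tendsto_nhds]
  intro ε hε
  obtain ⟨δ, hδ, hloc⟩ := hloc (ε / 2) (half_pos hε)
  have hM0 : 0 ≤ M := by
    obtain ⟨n, hn⟩ := hM.exists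
    exact (abs_nonneg _).trans (hn 0 (Nat.zero_le n))
  have hlim : Tendsto (fun n : ℕ => M / δ ^ 2 * (x * (1 - x) / n)) atTop (nhds 0) := by
    simpa using (tendsto_const_div_atTop_nhds_zero_nat (x * (1 - x))).const_mul (M / δ ^ 2)
  filter_upwards [hM, hloc, hlim.eventually (gt_mem_nhds (half_pos hε)), eventually_ne_atTop 0]
    with n hMn hlocn hsmall hn
  have hpt : ∀ k ≤ n, |φ n k - c| ≤ ε / 2 + M / δ ^ 2 * ((k : ℝ) / n - x) ^ 2 := by
    intro k hk
    rcases lt_or_ge |(k : ℝ) / n - x| δ with h | h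
    · exact (hlocn k hk h).trans (le_add_of_nonneg_right (by positivity))
    · have h1 : δ ^ 2 ≤ ((k : ℝ) / n - x) ^ 2 := by
        rw [← sq_abs ((k : ℝ) / n - x)]
        gcongr
      calc |φ n k - c| ≤ M := hMn k hk
        _ = M / δ ^ 2 * δ ^ 2 := by field_simp
        _ ≤ M / δ ^ 2 * ((k : ℝ) / n - x) ^ 2 := by gcongr
        _ ≤ _ := le_add_of_nonneg_left (half_pos hε).le
  have hdiff : ∑ k ∈ range (n + 1), φ n k * bern n k x - c
      = ∑ k ∈ range (n + 1), (φ n k - c) * bern n k x := by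
    simp only [sub_mul, sum_sub_distrib, ← mul_sum, sum_bern, mul_one]
  rw [Real.dist_eq, hdiff]
  calc |∑ k ∈ range (n + 1), (φ n k - c) * bern n k x|
      ≤ ∑ k ∈ range (n + 1), |(φ n k - c) * bern n k x| := abs_sum_le_sum_abs _ _
    _ ≤ ∑ k ∈ range (n + 1), (ε / 2 + M / δ ^ 2 * ((k : ℝ) / n - x) ^ 2) * bern n k x := by
        refine sum_le_sum fun k hk => ?_
        rw [abs_mul, abs_of_nonneg (bern_nonneg n k hx)]
        exact mul_le_mul_of_nonneg_right (hpt k (Nat.lt_succ_iff.1 (mem_range.1 hk)))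
          (bern_nonneg n k hx)
    _ = ε / 2 + M / δ ^ 2 * (x * (1 - x) / n) := by
        simp only [add_mul, sum_add_distrib, mul_assoc, ← mul_sum, sum_bern, mul_one,
          sum_sq_sub_mul_bern hn]
    _ < ε := by linarith

lemma akrNode_eq_sqrt {n : ℕ} (hn : 2 ≤ n) (k : ℕ) :
    akrNode n k =
      √(((k : ℝ) / n) ^ 2 - (k : ℝ) / n * (1 - (k : ℝ) / n) * (1 / ((n : ℝ) - 1))) := by
  have h2 : (2 : ℝ) ≤ n := by exact_mod_cast hn
  have h0 : (n : ℝ) ≠ 0 := by positivity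
  have h1 : (n : ℝ) - 1 ≠ 0 := by linarith
  unfold akrNode
  congr 1
  field_simp
  ring

lemma sq_akrNode {n : ℕ} (hn : 2 ≤ n) (k : ℕ) :
    akrNode n k ^ 2 =
      ((k : ℝ) / n) ^ 2 - (k : ℝ) / n * (1 - (k : ℝ) / n) * (1 / ((n : ℝ) - 1)) := by
  have h2 : (2 : ℝ) ≤ n := by exact_mod_cast hn
  have h0 : (n : ℝ) ≠ 0 := by positivity
  have h1 : (0 : ℝ) < (n : ℝ) - 1 := by linarith
  have hk : (0 : ℝ) ≤ k * (k - 1) := by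
    rcases Nat.eq_zero_or_pos k with rfl | h
    · simp
    · have : (1 : ℝ) ≤ k := by exact_mod_cast h
      exact mul_nonneg (by positivity) (by linarith)
  unfold akrNode
  rw [Real.sq_sqrt (by positivity)]
  field_simp
  ring

lemma akrNode_zero (n : ℕ) : akrNode n 0 = 0 := by simp [akrNode]

lemma mul_div_sub_akrNode {n : ℕ} (hn : 2 ≤ n) (k : ℕ) :
    (n : ℝ) * ((k : ℝ) / n - akrNode n k) =
      (1 + 1 / ((n : ℝ) - 1)) * ((k : ℝ) / n * (1 - (k : ℝ) / n)) /
        ((k : ℝ) / n + akrNode n k) := by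
  rcases Nat.eq_zero_or_pos k with rfl | hk
  · simp [akrNode_zero]
  have h2 : (2 : ℝ) ≤ n := by exact_mod_cast hn
  have h0 : (0 : ℝ) < n := by positivity
  have h1 : (n : ℝ) - 1 ≠ 0 := by linarith
  have hs : (0 : ℝ) < (k : ℝ) / n := by positivity
  have ht : 0 ≤ akrNode n k := Real.sqrt_nonneg _
  have hsq := sq_akrNode hn k
  have hn1 : (n : ℝ) * (1 / ((n : ℝ) - 1)) = 1 + 1 / ((n : ℝ) - 1) := by
    field_simp
    ring
  rw [eq_div_iff (by positivity), ← hn1]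
  linear_combination (-(n : ℝ)) * hsq

lemma mul_div_sub_akrNode_mem {n k : ℕ} (hn : 2 ≤ n) (hk : k ≤ n) :
    (n : ℝ) * ((k : ℝ) / n - akrNode n k) ∈ Set.Icc (0 : ℝ) 2 := by
  have h2 : (2 : ℝ) ≤ n := by exact_mod_cast hn
  have h0 : (0 : ℝ) < n := by positivity
  have hs0 : (0 : ℝ) ≤ (k : ℝ) / n := by positivity
  have hs1 : (k : ℝ) / n ≤ 1 := div_le_one_of_le₀ (by exact_mod_cast hk) h0.le
  have hs1' : 0 ≤ 1 - (k : ℝ) / n := sub_nonneg.2 hs1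
  have ht : 0 ≤ akrNode n k := Real.sqrt_nonneg _
  have hu0 : 0 ≤ 1 / ((n : ℝ) - 1) := one_div_nonneg.2 (by linarith)
  have hu1 : 1 / ((n : ℝ) - 1) ≤ 1 := div_le_one_of_le₀ (by linarith) (by linarith)
  rw [mul_div_sub_akrNode hn]
  refine ⟨by positivity, div_le_of_le_mul₀ (by positivity) zero_le_two ?_⟩
  have h3 : (k : ℝ) / n * (1 - (k : ℝ) / n) ≤ (k : ℝ) / n :=
    mul_le_of_le_one_right hs0 (by linarith)
  calc (1 + 1 / ((n : ℝ) - 1)) * ((k : ℝ) / n * (1 - (k : ℝ) / n))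
      ≤ 2 * ((k : ℝ) / n) := by gcongr; linarith
    _ ≤ 2 * ((k : ℝ) / n + akrNode n k) := by linarith

lemma akrNode_mem_Icc {n k : ℕ} (hn : 2 ≤ n) (hk : k ≤ n) : akrNode n k ∈ Set.Icc (0 : ℝ) 1 := by
  have h0 : (0 : ℝ) < n := by positivity
  have hs1 : (k : ℝ) / n ≤ 1 := div_le_one_of_le₀ (by exact_mod_cast hk) h0.le
  have h := nonneg_of_mul_nonneg_right (mul_div_sub_akrNode_mem hn hk).1 h0
  exact ⟨Real.sqrt_nonneg _, by linarith⟩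

/-- Near `x`, the nodes tend to `x` and the scaled node displacements to `(1 - x) / 2`. -/
lemma exists_akrNode_close {x : ℝ} (hx : 0 < x) {ε : ℝ} (hε : 0 < ε) :
    ∃ δ > 0, ∀ᶠ n : ℕ in atTop, ∀ k : ℕ, |(k : ℝ) / n - x| < δ →
      |akrNode n k - x| < ε ∧
        |(n : ℝ) * ((k : ℝ) / n - akrNode n k) - (1 - x) / 2| < ε := by
  let T : ℝ × ℝ → ℝ := fun p => √(p.2 ^ 2 - p.2 * (1 - p.2) * p.1)
  let F : ℝ × ℝ → ℝ := fun p => (1 + p.1) * (p.2 * (1 - p.2)) / (p.2 + T p)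
  have hT : Continuous T := by fun_prop
  have hT0 : T (0, x) = x := by simp [T, Real.sqrt_sq hx.le]
  have hF : ContinuousAt F (0, x) :=
    ContinuousAt.div (by fun_prop) (by fun_prop) (by rw [hT0]; positivity)
  have hF0 : F (0, x) = (1 - x) / 2 := by
    simp only [F, hT0]
    field_simp
    ring
  have hTε : ∀ᶠ p in nhds ((0 : ℝ), x), |T p - x| < ε := by
    simpa [hT0, Real.dist_eq] using Metric.tendsto_nhds.1 (hT.tendsto (0, x)) ε hε
  have hFε : ∀ᶠ p in nhds ((0 : ℝ), x), |F p - (1 - x) / 2| < ε := by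
    simpa [hF0, Real.dist_eq] using Metric.tendsto_nhds.1 hF ε hε
  obtain ⟨δ, hδ, hball⟩ := Metric.eventually_nhds_iff.1 (hTε.and hFε)
  have hu : Tendsto (fun n : ℕ => 1 / ((n : ℝ) - 1)) atTop (nhds 0) := by
    simp only [one_div]
    exact tendsto_inv_atTop_zero.comp
      (tendsto_atTop_add_const_right _ (-1) tendsto_natCast_atTop_atTop)
  refine ⟨δ, hδ, ?_⟩
  filter_upwards [Metric.tendsto_nhds.1 hu δ hδ, eventually_ge_atTop 2] with n hun hn k hk
  have h := @hball (1 / ((n : ℝ) - 1), (k : ℝ) / n) (by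
    rw [Prod.dist_eq, max_lt_iff]
    exact ⟨hun, hk⟩)
  rw [mul_div_sub_akrNode hn, akrNode_eq_sqrt hn]
  exact h

/-- A mean value estimate for the deviation of `f` from a linear map on a convex set. -/
lemma abs_sub_sub_mul_le {f f' : ℝ → ℝ} {S : Set ℝ} (hS : Convex ℝ S) {a C s t : ℝ}
    (hf : ∀ y ∈ S, HasDerivWithinAt f (f' y) S y) (hC : ∀ y ∈ S, |f' y - a| ≤ C)
    (hs : s ∈ S) (ht : t ∈ S) : |f t - f s - a * (t - s)| ≤ C * |t - s| := by
  have h := hS.norm_image_sub_le_of_norm_hasDerivWithin_le (f := fun y => f y - a * y)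
    (f' := fun y => f' y - a) (C := C)
    (fun y hy => by
      simpa using (hf y hy).fun_sub ((hasDerivWithinAt_id y S).const_mul a)) hC hs ht
  simp only [Real.norm_eq_abs] at h
  convert h using 2
  ring

theorem stmt_7 (x : ℝ) (hx : x ∈ Set.Ioc (0 : ℝ) 1) (f : ℝ → ℝ)
    (hf : ContDiffOn ℝ 2 f (Set.Icc 0 1)) :
    Tendsto (fun n : ℕ => (n : ℝ) * (akrOp n f x - bernsteinOp n f x)) atTop
      (nhds (-((1 - x) / 2) * derivWithin f (Set.Icc 0 1) x)) := by
  set I : Set ℝ := Set.Icc 0 1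
  set f' : ℝ → ℝ := derivWithin f I
  have hxI : x ∈ I := ⟨hx.1.le, hx.2⟩
  have hder : ∀ y ∈ I, HasDerivWithinAt f (f' y) I y := fun y hy =>
    (hf.differentiableOn (by norm_num) y hy).hasDerivWithinAt
  have hcont : ContinuousOn f' I :=
    hf.continuousOn_derivWithin (uniqueDiffOn_Icc zero_lt_one) (by norm_num)
  have hnode : ∀ n k : ℕ, k ≤ n → (k : ℝ) / n ∈ I := fun n k hk =>
    ⟨by positivity, div_le_one_of_le₀ (by exact_mod_cast hk) (by positivity)⟩
  have hgap : ∀ n k : ℕ, 2 ≤ n → k ≤ n → (n : ℝ) * |akrNode n k - (k : ℝ) / n| ≤ 2 := by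
    intro n k hn hk
    have h := mul_div_sub_akrNode_mem hn hk
    have h0 : (0 : ℝ) < n := by positivity
    rw [abs_sub_comm, abs_of_nonneg (nonneg_of_mul_nonneg_right h.1 h0)]
    exact h.2
  have hsum : ∀ n : ℕ, (n : ℝ) * (akrOp n f x - bernsteinOp n f x) =
      ∑ k ∈ range (n + 1), (n : ℝ) * (f (akrNode n k) - f ((k : ℝ) / n)) * bern n k x := by
    intro n
    simp only [akrOp, bernsteinOp, ← sum_sub_distrib, ← sub_mul, mul_sum, mul_assoc]
  simp only [hsum]
  obtain ⟨L, hL⟩ := isCompact_Icc.exists_bound_of_continuousOn hcont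
  have hL0 : 0 ≤ L := (norm_nonneg _).trans (hL x hxI)
  refine tendsto_sum_mul_bern hxI _ _ (L * 2 + |-((1 - x) / 2) * f' x|) ?_ ?_
  · filter_upwards [eventually_ge_atTop 2] with n hn k hk
    refine (abs_sub _ _).trans (add_le_add_left ?_ _)
    have h := abs_sub_sub_mul_le (a := 0) (convex_Icc 0 1) hder
      (fun y hy => by simpa using hL y hy) (hnode n k hk) (akrNode_mem_Icc hn hk)
    rw [zero_mul, sub_zero] at h
    rw [abs_mul, Nat.abs_cast]
    calc (n : ℝ) * |f (akrNode n k) - f ((k : ℝ) / n)|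
        ≤ n * (L * |akrNode n k - (k : ℝ) / n|) := by gcongr
      _ = L * (n * |akrNode n k - (k : ℝ) / n|) := by ring
      _ ≤ L * 2 := by gcongr; exact hgap n k hn hk
  · intro ε hε
    have hη : 0 < ε / (2 + |f' x|) := by positivity
    set η := ε / (2 + |f' x|)
    obtain ⟨r, hr, hclose⟩ := Metric.continuousWithinAt_iff.1 (hcont x hxI) η hη
    obtain ⟨δ, hδ, hev⟩ := exists_akrNode_close hx.1 (lt_min hr hη)
    refine ⟨min δ r, lt_min hδ hr, ?_⟩
    filter_upwards [hev, eventually_ge_atTop 2] with n hevn hn k hk hkx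
    obtain ⟨h1, h2⟩ := hevn k (hkx.trans_le (min_le_left _ _))
    have hmv := abs_sub_sub_mul_le (a := f' x) (C := η) (S := I ∩ Metric.ball x r)
      ((convex_Icc 0 1).inter (convex_ball x r))
      (fun y hy => (hder y hy.1).mono Set.inter_subset_left)
      (fun y hy => (hclose hy.1 hy.2).le)
      ⟨hnode n k hk, hkx.trans_le (min_le_right _ _)⟩
      ⟨akrNode_mem_Icc hn hk, h1.trans_le (min_le_left _ _)⟩
    have hsplit : (n : ℝ) * (f (akrNode n k) - f ((k : ℝ) / n)) - -((1 - x) / 2) * f' x =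
        n * (f (akrNode n k) - f ((k : ℝ) / n) - f' x * (akrNode n k - (k : ℝ) / n)) -
          f' x * (n * ((k : ℝ) / n - akrNode n k) - (1 - x) / 2) := by ring
    rw [hsplit]
    refine (abs_sub _ _).trans ?_
    rw [abs_mul, abs_mul, Nat.abs_cast]
    calc _ ≤ (n : ℝ) * (η * |akrNode n k - (k : ℝ) / n|) + |f' x| * η := by
          gcongr
          exact h2.le.trans (min_le_right _ _)
      _ = η * (n * |akrNode n k - (k : ℝ) / n|) + |f' x| * η := by ring
      _ ≤ η * 2 + |f' x| * η := by gcongr; exact hgap n k hn hk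
      _ = η * (2 + |f' x|) := by ring
      _ = ε := div_mul_cancel₀ _ (by positivity)
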